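/- Super-majoritarian quota rules are safe on agendas of additive linear logic formulas: for every agenda Φ of ALL formulas, every odd number n ≥ 3 of agents, every quota m with m > n/2, and every profile (J_1,…,J_n) of judgment sets over Φ that are complete and robustly consistent (in ALL C), the outcome F_m(J) = {φ ∈ Φ : |N_φ| ≥ m} is robustly consistent in ALL C. -/

import Mathlib

namespace Stmt17

/-- Formulas of additive linear logic (ALL): atoms, linear negation, & and ⊕, no units. -/
inductive AForm : Type
  | atom  : ℕ → AForm
  | neg   : AForm → AForm
  | awith : AForm → AForm → AForm         -- &
  | aplus : AForm → AForm → AForm         -- ⊕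
  deriving DecidableEq

/-- Sequent calculus for ALL C: the ALL rules plus left and right contraction. -/
inductive ACDeriv : Multiset AForm → Multiset AForm → Prop
  | ax (A) : ACDeriv {A} {A}
  | cut {Γ Δ Γ' Δ' A} : ACDeriv (A ::ₘ Γ) Δ → ACDeriv Γ' (A ::ₘ Δ') →
      ACDeriv (Γ + Γ') (Δ + Δ')
  | negL {Γ Δ A} : ACDeriv Γ (A ::ₘ Δ) → ACDeriv (AForm.neg A ::ₘ Γ) Δ
  | negR {Γ Δ A} : ACDeriv (A ::ₘ Γ) Δ → ACDeriv Γ (AForm.neg A ::ₘ Δ)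
  | withR {Γ Δ A B} : ACDeriv Γ (A ::ₘ Δ) → ACDeriv Γ (B ::ₘ Δ) →
      ACDeriv Γ (AForm.awith A B ::ₘ Δ)
  | withL1 {Γ Δ A B} : ACDeriv (A ::ₘ Γ) Δ → ACDeriv (AForm.awith A B ::ₘ Γ) Δ
  | withL2 {Γ Δ A B} : ACDeriv (B ::ₘ Γ) Δ → ACDeriv (AForm.awith A B ::ₘ Γ) Δ
  | plusL {Γ Δ A B} : ACDeriv (A ::ₘ Γ) Δ → ACDeriv (B ::ₘ Γ) Δ →
      ACDeriv (AForm.aplus A B ::ₘ Γ) Δ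
  | plusR1 {Γ Δ A B} : ACDeriv Γ (A ::ₘ Δ) → ACDeriv Γ (AForm.aplus A B ::ₘ Δ)
  | plusR2 {Γ Δ A B} : ACDeriv Γ (B ::ₘ Δ) → ACDeriv Γ (AForm.aplus A B ::ₘ Δ)
  | contrL {Γ Δ A} : ACDeriv (A ::ₘ A ::ₘ Γ) Δ → ACDeriv (A ::ₘ Γ) Δ
  | contrR {Γ Δ A} : ACDeriv Γ (A ::ₘ A ::ₘ Δ) → ACDeriv Γ (A ::ₘ Δ)

/-- ALL C-inconsistency. -/
def ACInconsistent (Γ : Multiset AForm) : Prop := ACDeriv Γ 0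

/-- Robust consistency in ALL C. -/
def robustlyConsistentC (Γ : Multiset AForm) : Prop :=
  ∀ Δ : Multiset AForm, Δ ≤ Γ → ¬ ACInconsistent Δ

def AForm.compl : AForm → AForm
  | .neg ψ => ψ
  | φ      => .neg φ

def completeOn (Φ J : Finset AForm) : Prop := ∀ φ ∈ Φ, φ ∈ J ∨ φ.compl ∈ J

def isAgenda (Φ : Finset AForm) : Prop :=
  (∀ φ ∈ Φ, φ.compl ∈ Φ) ∧ ∀ φ ∈ Φ, ¬ ACDeriv 0 {φ} ∧ ¬ ACDeriv {φ} 0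

def nsupp (n : ℕ) (J : Fin n → Finset AForm) (φ : AForm) : ℕ :=
  (Finset.univ.filter (fun i => φ ∈ J i)).card

/-- The uniform quota rule with quota m. -/
def quotaRule (n m : ℕ) (Φ : Finset AForm) (J : Fin n → Finset AForm) : Finset AForm :=
  Φ.filter (fun φ => m ≤ nsupp n J φ)

/-- Every derivable sequent of ALL C has at most two formulas. -/
lemma ACDeriv.card_le {Γ Δ : Multiset AForm} (h : ACDeriv Γ Δ) :
    Multiset.card Γ + Multiset.card Δ ≤ 2 := by
  induction h <;> simp only [Multiset.card_cons, Multiset.card_add, Multiset.card_singleton] at * <;>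
    omega

/-- Two formulas with majority support share a supporter. -/
lemma exists_common (n m : ℕ) (hm : n < 2 * m) (J : Fin n → Finset AForm) (a b : AForm)
    (ha : m ≤ nsupp n J a) (hb : m ≤ nsupp n J b) : ∃ i, a ∈ J i ∧ b ∈ J i := by
  by_contra hcon
  push Not at hcon
  have hd : Disjoint (Finset.univ.filter (fun i => a ∈ J i))
      (Finset.univ.filter (fun i => b ∈ J i)) := by
    rw [Finset.disjoint_left]
    intro i hi hi'
    exact hcon i (Finset.mem_filter.1 hi).2 (Finset.mem_filter.1 hi').2
  have h1 := Finset.card_le_univ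
    ((Finset.univ.filter (fun i => a ∈ J i)) ∪ (Finset.univ.filter (fun i => b ∈ J i)))
  rw [Finset.card_union_of_disjoint hd, Fintype.card_fin] at h1
  unfold nsupp at ha hb
  omega

/-- super-majoritarian quota rules are safe on ALL agendas: for every
agenda Φ of ALL formulas, every odd n ≥ 3, every quota m with m > n/2, and every
profile of complete judgment sets robustly consistent in ALL C, the quota-rule outcome
F_m(J) = {φ ∈ Φ : |N_φ| ≥ m} is robustly consistent in ALL C. -/
theorem supermajoritarian_quota_safe
    (Φ : Finset AForm) (hΦ : isAgenda Φ)
    (n : ℕ) (hodd : Odd n) (h3 : 3 ≤ n)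
    (m : ℕ) (hm : n < 2 * m)
    (J : Fin n → Finset AForm)
    (hJ : ∀ i, J i ⊆ Φ ∧ completeOn Φ (J i) ∧ robustlyConsistentC (J i).val) :
    robustlyConsistentC (quotaRule n m Φ J).val := by
  intro Δ hΔ hinc
  have hcard := ACDeriv.card_le hinc
  have hnd : Δ.Nodup := Multiset.nodup_of_le hΔ (quotaRule n m Φ J).nodup
  have hsub : ∀ a ∈ Δ, m ≤ nsupp n J a := fun a ha =>
    (Finset.mem_filter.1 (show a ∈ quotaRule n m Φ J from Finset.mem_val ▸ Multiset.mem_of_le hΔ ha)).2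
  suffices h : ∃ i, ∀ a ∈ Δ, a ∈ J i by
    obtain ⟨i, hi⟩ := h
    exact (hJ i).2.2 Δ ((Multiset.le_iff_subset hnd).2 hi) hinc
  have hc : Multiset.card Δ = 0 ∨ Multiset.card Δ = 1 ∨ Multiset.card Δ = 2 := by
    simp only [Multiset.card_zero] at hcard
    omega
  rcases hc with h | h | h
  · rw [Multiset.card_eq_zero] at h
    subst h
    exact ⟨⟨0, by omega⟩, by simp⟩
  · obtain ⟨a, rfl⟩ := Multiset.card_eq_one.1 h
    obtain ⟨i, hi, _⟩ := exists_common n m hm J a a (hsub a (by simp)) (hsub a (by simp))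
    exact ⟨i, by simpa using hi⟩
  · obtain ⟨a, b, rfl⟩ := Multiset.card_eq_two.1 h
    obtain ⟨i, hi, hi2⟩ := exists_common n m hm J a b (hsub a (by simp)) (hsub b (by simp))
    exact ⟨i, by simp [hi, hi2]⟩

end Stmt17
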